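/- Let q ≡ 1 (mod 5), let λ ∈ F_q^*, and let a, b be integers with 1 ≤ a, b ≤ 4. Let C_λ be the affine curve y^5 = x^a(1-x)^b(1-λx)^{5-b} over F_q. Then, as complex numbers, the number of pairs (x,y) ∈ F_q × F_q satisfying its equation equals q + Σ_χ ( (1/(q−1)) Σ_η q^{1−ν} · G(φ,χ^a η)·G(φ,χ^b η) / ( G(φ,η)·G(φ,χ^{a+b}η) ) · η(λ) ), where the outer sum runs over all nontrivial multiplicative characters χ of F_q^* with χ^5 = 1, the inner sum runs over all multiplicative characters η of F_q^*, and ν is the number of trivial characters among the pair (η, χ^{a+b}η). -/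

import Mathlib

/-- The group of multiplicative characters of a finite field with values in `ℂ` is finite. -/
noncomputable instance {F : Type*} [Field F] [Fintype F] : Fintype (MulChar F ℂ) :=
  Fintype.ofFinite _

/-- The Gauss sum `G(φ, χ) = ∑_{x ∈ F*} φ(x) χ(x)`. -/
noncomputable def gaussSum' {F : Type*} [Field F] [Fintype F]
    (φ : AddChar F ℂ) (χ : MulChar F ℂ) : ℂ :=
  letI := Classical.decEq F
  ∑ x : Fˣ, φ (x : F) * χ (x : F)

section CharacterSums

open Finset

variable {F : Type*} [Field F]

theorem MulChar.unit_apply_ne_zero (χ : MulChar F ℂ) (u : Fˣ) : χ (u : F) ≠ 0 :=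
  (u.isUnit.map χ).ne_zero

variable [Fintype F]

theorem gaussSum'_eq_sum_units [DecidableEq F] (φ : AddChar F ℂ) (χ : MulChar F ℂ) :
    gaussSum' φ χ = ∑ x : Fˣ, φ (x : F) * χ (x : F) := by
  unfold gaussSum'
  convert rfl

theorem sum_units_eq_sum [DecidableEq F] {f : F → ℂ} (hf : f 0 = 0) :
    ∑ x : Fˣ, f x = ∑ x : F, f x := by
  refine Fintype.sum_of_injective Units.val Units.val_injective _ _ (fun x hx => ?_)
    fun _ => rfl
  by_cases h : x = 0
  · rw [h, hf]
  · exact absurd ⟨Units.mk0 x h, rfl⟩ hx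

theorem gaussSum'_eq_gaussSum (φ : AddChar F ℂ) (χ : MulChar F ℂ) :
    gaussSum' φ χ = gaussSum χ φ := by
  classical
  rw [gaussSum'_eq_sum_units, sum_units_eq_sum (f := fun x => φ x * χ x) (by simp [χ.map_zero])]
  simp only [gaussSum, mul_comm]

theorem MulChar.sum_apply_eq_ite [DecidableEq F] (u : F) :
    ∑ η : MulChar F ℂ, η u = if u = 1 then (Fintype.card F : ℂ) - 1 else 0 := by
  split_ifs with h
  · subst h
    have hc : Fintype.card (MulChar F ℂ) = Fintype.card F - 1 := by
      rw [← Nat.card_eq_fintype_card, MulChar.card_eq_card_units_of_hasEnoughRootsOfUnity F ℂ,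
        Nat.card_eq_fintype_card, Fintype.card_units]
    simp only [map_one, sum_const, card_univ, nsmul_eq_mul, mul_one, hc]
    rw [Nat.cast_sub Fintype.card_pos, Nat.cast_one]
  · obtain ⟨χ, hχ⟩ := MulChar.exists_apply_ne_one_of_hasEnoughRootsOfUnity F ℂ h
    refine eq_zero_of_mul_eq_self_left hχ ?_
    rw [Finset.mul_sum]
    exact Fintype.sum_bijective _ (Group.mulLeft_bijective χ) _ _ fun η => rfl

theorem sum_units_addChar [DecidableEq F] {φ : AddChar F ℂ} (hφ : φ ≠ 1) (c : F) :
    ∑ w : Fˣ, φ (w * c) = (if c = 0 then (Fintype.card F : ℂ) else 0) - 1 := by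
  have h1 : ∑ w : Fˣ, φ (w * c) = ∑ w : Fˣ, (φ (w * c) - if (w : F) = 0 then 1 else 0) := by
    simp
  rw [h1, sum_units_eq_sum (f := fun w => φ (w * c) - if w = 0 then 1 else 0) (by simp),
    sum_sub_distrib, AddChar.sum_mulShift c (AddChar.IsPrimitive.of_ne_one hφ)]
  simp

theorem MulChar.sum_units_eq_zero [DecidableEq F] {χ : MulChar F ℂ} (hχ : χ ≠ 1) :
    ∑ x : Fˣ, χ (x : F) = 0 := by
  rw [sum_units_eq_sum (f := fun x => χ x) (by simp), MulChar.sum_eq_zero_of_ne_one hχ]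

theorem gaussSum'_mul_gaussSum'_inv [DecidableEq (MulChar F ℂ)] {φ : AddChar F ℂ} (hφ : φ ≠ 1)
    (χ : MulChar F ℂ) :
    gaussSum' φ χ * gaussSum' φ χ⁻¹ =
      χ (-1) * (Fintype.card F : ℂ) ^ ((1 : ℤ) - if χ = 1 then 1 else 0) := by
  simp only [gaussSum'_eq_gaussSum]
  split_ifs with h
  · subst h
    simp [gaussSum_one_left hφ, MulChar.one_apply]
  · rw [← mul_gaussSum_inv_eq_gaussSum χ⁻¹, mul_left_comm,
      gaussSum_mul_gaussSum_eq_card h (AddChar.IsPrimitive.of_ne_one hφ), MulChar.inv_apply',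
      inv_neg_one]
    simp

theorem gaussSum'_eq_sum_mul_left [DecidableEq F] (φ : AddChar F ℂ) (χ : MulChar F ℂ) (w : Fˣ) :
    gaussSum' φ χ = ∑ s : Fˣ, φ (w * s) * (χ w * χ s) := by
  rw [gaussSum'_eq_sum_units]
  refine (Fintype.sum_bijective _ (Group.mulLeft_bijective w) _ _ fun s => ?_).symm
  simp

theorem prod_gaussSum'_mul_apply [DecidableEq F] (φ : AddChar F ℂ) (A B η : MulChar F ℂ)
    (l : Fˣ) :
    gaussSum' φ (A * η) * gaussSum' φ (B * η) * gaussSum' φ η⁻¹ * gaussSum' φ (A * B * η)⁻¹ *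
        η l =
      ∑ w : Fˣ, ∑ s : Fˣ, ∑ t : Fˣ, ∑ z : Fˣ,
        φ (w * (1 + s + t + z)) * (A s * B t) * η ((l * s * t * z⁻¹ : Fˣ) : F) := by
  rw [gaussSum'_eq_sum_units φ (A * B * η)⁻¹, mul_sum, sum_mul]
  refine sum_congr rfl fun w _ => ?_
  rw [gaussSum'_eq_sum_mul_left φ (A * η) w, gaussSum'_eq_sum_mul_left φ (B * η) w,
    gaussSum'_eq_sum_mul_left φ η⁻¹ w]
  have h (s t z : Fˣ) : φ (w * (1 + s + t + z)) * (A s * B t) * η ((l * s * t * z⁻¹ : Fˣ) : F) =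
      (φ (w * s) * ((A * η) w * (A * η) s)) * ((φ (w * t) * ((B * η) w * (B * η) t)) *
        ((φ (w * z) * (η⁻¹ w * η⁻¹ z)) * (φ w * (A * B * η)⁻¹ w * η l))) := by
    have hA := A.unit_apply_ne_zero w
    have hB := B.unit_apply_ne_zero w
    have hη := η.unit_apply_ne_zero w
    have hz := η.unit_apply_ne_zero z
    have hzi : η (z : F)⁻¹ = (η z)⁻¹ := by rw [← MulChar.inv_apply', MulChar.inv_apply_eq_inv']
    simp only [mul_add, mul_one, AddChar.map_add_eq_mul, MulChar.mul_apply,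
      MulChar.inv_apply_eq_inv', Units.val_mul, Units.val_inv_eq_inv_val, map_mul, hzi]
    field_simp
  simp only [h, ← mul_sum, ← sum_mul]
  ring

theorem sum_prod_gaussSum' [DecidableEq F] (φ : AddChar F ℂ) (A B : MulChar F ℂ) (l : Fˣ) :
    ∑ η : MulChar F ℂ, gaussSum' φ (A * η) * gaussSum' φ (B * η) * gaussSum' φ η⁻¹ *
        gaussSum' φ (A * B * η)⁻¹ * η l =
      ((Fintype.card F : ℂ) - 1) * ∑ s : Fˣ, ∑ t : Fˣ,
        (A s * B t) * ∑ w : Fˣ, φ (w * (1 + s + t + l * s * t)) := by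
  simp only [prod_gaussSum'_mul_apply]
  rw [sum_comm]
  have h (w : Fˣ) : ∑ η : MulChar F ℂ, ∑ s : Fˣ, ∑ t : Fˣ, ∑ z : Fˣ,
        φ (w * (1 + s + t + z)) * (A s * B t) * η ((l * s * t * z⁻¹ : Fˣ) : F) =
      ∑ s : Fˣ, ∑ t : Fˣ, ((Fintype.card F : ℂ) - 1) *
        (φ (w * (1 + s + t + l * s * t)) * (A s * B t)) := by
    rw [sum_comm]
    refine sum_congr rfl fun s _ => ?_
    rw [sum_comm]
    refine sum_congr rfl fun t _ => ?_
    rw [sum_comm]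
    simp only [← mul_sum, MulChar.sum_apply_eq_ite, Units.val_eq_one, mul_inv_eq_one, mul_ite,
      mul_zero, sum_ite_eq, mem_univ, if_true]
    push_cast
    ring
  simp only [h]
  rw [sum_comm, mul_sum]
  refine sum_congr rfl fun s _ => ?_
  rw [sum_comm, mul_sum]
  refine sum_congr rfl fun t _ => ?_
  rw [← mul_sum, ← sum_mul, mul_comm (A s * B t)]

theorem sum_units_apply_of_linear [DecidableEq F] {B : MulChar F ℂ} (hB : B ≠ 1) (c d : F) :
    ∑ t : Fˣ, B (t : F) * (if c + t * d = 0 then 1 else 0) = B (-c) * B⁻¹ d := by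
  by_cases hd : d = 0
  · subst hd
    by_cases hc : c = 0
    · simp [hc, MulChar.sum_units_eq_zero hB, B.map_zero]
    · simp [hc, B⁻¹.map_zero]
  · rw [sum_units_eq_sum (f := fun t => B t * (if c + t * d = 0 then 1 else 0))
        (by simp [B.map_zero]),
      sum_eq_single (-c / d), if_pos (by field_simp; ring), div_eq_mul_inv, map_mul,
      MulChar.inv_apply', mul_one]
    · intro t _ ht
      rw [if_neg, mul_zero]
      contrapose! ht
      rw [eq_div_iff hd]
      linear_combination ht
    · simp

theorem sum_prod_gaussSum'_eq_sum_apply {φ : AddChar F ℂ} (hφ : φ ≠ 1) {A B : MulChar F ℂ}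
    (hB : B ≠ 1) (hA1 : A (-1) = 1) (hB1 : B (-1) = 1) {lam : F}
    (hlam : lam ≠ 0) :
    ∑ η : MulChar F ℂ, gaussSum' φ (A * η) * gaussSum' φ (B * η) * gaussSum' φ η⁻¹ *
        gaussSum' φ (A * B * η)⁻¹ * η lam =
      ((Fintype.card F : ℂ) - 1) * Fintype.card F *
        ∑ x : F, A x * B (1 - x) * B⁻¹ (1 - lam * x) := by
  classical
  have h := sum_prod_gaussSum' φ A B (Units.mk0 lam hlam)
  simp only [Units.val_mk0] at h
  rw [h, mul_assoc]
  congr 1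
  have h1 (s : Fˣ) : ∑ t : Fˣ, A (s : F) * B (t : F) *
      ∑ w : Fˣ, φ (w * (1 + s + t + lam * s * t)) =
      Fintype.card F * (A s * (B (-(1 + s)) * B⁻¹ (1 + lam * s))) := by
    rw [← sum_units_apply_of_linear hB]
    simp only [sum_units_addChar hφ]
    have h2 (t : Fˣ) : A (s : F) * B (t : F) *
        ((if 1 + (s : F) + t + lam * s * t = 0 then (Fintype.card F : ℂ) else 0) - 1) =
        Fintype.card F * (A s * (B t * (if 1 + (s : F) + t * (1 + lam * s) = 0 then 1 else 0))) -
          A s * B t := by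
      rw [show 1 + (s : F) + t + lam * s * t = 1 + s + t * (1 + lam * s) by ring]
      split_ifs <;> ring
    simp only [h2, sum_sub_distrib, ← mul_sum, MulChar.sum_units_eq_zero hB, mul_zero, sub_zero]
  simp only [h1, ← mul_sum]
  rw [sum_units_eq_sum
    (f := fun s => A s * (B (-(1 + s)) * B⁻¹ (1 + lam * s))) (by simp [A.map_zero])]
  congr 1
  refine Fintype.sum_equiv (Equiv.neg F) _ _ fun s => ?_
  have hA (x : F) : A (-x) = A x := by rw [← neg_one_mul, map_mul, hA1, one_mul]
  have hB (x : F) : B (-x) = B x := by rw [← neg_one_mul, map_mul, hB1, one_mul]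
  simp only [Equiv.neg_apply, hA, hB, sub_neg_eq_add, mul_neg, mul_assoc]

theorem gaussSum'_quotient [DecidableEq (MulChar F ℂ)] {φ : AddChar F ℂ} (hφ : φ ≠ 1)
    {P η : MulChar F ℂ} (hP : P (-1) = 1) (c d : ℂ) :
    (Fintype.card F : ℂ) ^ ((1 : ℤ) - ((if η = 1 then 1 else 0) + (if P * η = 1 then 1 else 0))) *
        c / (gaussSum' φ η * gaussSum' φ (P * η)) * d =
      (Fintype.card F : ℂ)⁻¹ * (c * gaussSum' φ η⁻¹ * gaussSum' φ (P * η)⁻¹ * d) := by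
  have hq : (Fintype.card F : ℂ) ≠ 0 := Nat.cast_ne_zero.2 Fintype.card_ne_zero
  have h1 := gaussSum'_mul_gaussSum'_inv hφ η
  have h2 := gaussSum'_mul_gaussSum'_inv hφ (P * η)
  have hη : η (-1) * η (-1) = 1 := by rw [← map_mul]; simp
  have hη0 : η (-1) ≠ 0 := left_ne_zero_of_mul_eq_one hη
  rw [MulChar.mul_apply, hP, one_mul] at h2
  generalize (if η = 1 then (1 : ℤ) else 0) = i at *
  generalize (if P * η = 1 then (1 : ℤ) else 0) = j at *
  have hg1 : gaussSum' φ η ≠ 0 :=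
    left_ne_zero_of_mul (h1.trans_ne (mul_ne_zero hη0 (zpow_ne_zero _ hq)))
  have hg2 : gaussSum' φ (P * η) ≠ 0 :=
    left_ne_zero_of_mul (h2.trans_ne (mul_ne_zero hη0 (zpow_ne_zero _ hq)))
  have h3 : (Fintype.card F : ℂ) ^ ((1 : ℤ) - (i + j)) =
      (Fintype.card F : ℂ)⁻¹ * ((gaussSum' φ η * gaussSum' φ η⁻¹) *
        (gaussSum' φ (P * η) * gaussSum' φ (P * η)⁻¹)) := by
    rw [h1, h2, mul_mul_mul_comm, hη, one_mul, ← zpow_add₀ hq, ← zpow_neg_one, ← zpow_add₀ hq]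
    congr 1
    ring
  rw [h3]
  field_simp

theorem MulChar.card_pow_eq [DecidableEq F] [DecidableEq (MulChar F ℂ)] {n : ℕ} (hn : n ≠ 0)
    (u : F) :
    (#{y : F | y ^ n = u} : ℂ) =
      (if u = 0 then 1 else 0) + ∑ χ : MulChar F ℂ with χ ^ n = 1, χ u := by
  by_cases hu : u = 0
  · subst hu
    simp [hn, filter_eq']
  have hq : (Fintype.card F : ℂ) - 1 ≠ 0 := by
    rw [sub_ne_zero]
    exact_mod_cast Fintype.one_lt_card.ne'
  refine mul_left_cancel₀ hq ?_
  have h1 (y : F) : ((Fintype.card F : ℂ) - 1) * (if y ^ n = u then 1 else 0) =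
      ∑ η : MulChar F ℂ, η u * ((η ^ n)⁻¹ : MulChar F ℂ) y := by
    have h2 (η : MulChar F ℂ) : η u * ((η ^ n)⁻¹ : MulChar F ℂ) y = η (u * (y ^ n)⁻¹) := by
      rw [map_mul, MulChar.inv_apply', MulChar.pow_apply' _ hn, ← map_pow, inv_pow]
    simp only [h2, MulChar.sum_apply_eq_ite]
    have h3 : u * (y ^ n)⁻¹ = 1 ↔ y ^ n = u := by
      by_cases hy : y = 0
      · simp [hy, hn, Ne.symm hu]
      · rw [mul_inv_eq_one₀ (pow_ne_zero n hy), eq_comm]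
    simp [h3]
  rw [card_filter]
  push_cast
  rw [mul_sum]
  simp only [h1]
  rw [sum_comm, if_neg hu, zero_add, sum_filter, mul_sum]
  refine sum_congr rfl fun η _ => ?_
  rw [← mul_sum]
  split_ifs with h
  · rw [h, inv_one, MulChar.sum_one_eq_card_units, Fintype.card_units,
      Nat.cast_sub Fintype.card_pos, Nat.cast_one, mul_comm]
  · rw [MulChar.sum_eq_zero_of_ne_one (inv_ne_one.2 h), mul_zero, mul_zero]

theorem MulChar.card_pow_eq_apply [DecidableEq F] [DecidableEq (MulChar F ℂ)] {n : ℕ}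
    (hn : n ≠ 0) (f : F → F) :
    (Nat.card {pt : F × F // pt.2 ^ n = f pt.1} : ℂ) =
      Fintype.card F + ∑ χ : MulChar F ℂ with χ ≠ 1 ∧ χ ^ n = 1, ∑ x : F, χ (f x) := by
  have h1 : Nat.card {pt : F × F // pt.2 ^ n = f pt.1} = ∑ x : F, #{y : F | y ^ n = f x} := by
    rw [Nat.card_eq_fintype_card, Fintype.card_subtype, card_filter, Fintype.sum_prod_type]
    simp only [card_filter]
  have h2 (u : F) : (#{y : F | y ^ n = u} : ℂ) =
      1 + ∑ χ : MulChar F ℂ with χ ≠ 1 ∧ χ ^ n = 1, χ u := by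
    have h3 : ({χ : MulChar F ℂ | χ ^ n = 1} : Finset _) =
        insert 1 ({χ : MulChar F ℂ | χ ≠ 1 ∧ χ ^ n = 1} : Finset _) := by
      ext χ
      by_cases h : χ = 1 <;> simp [h]
    rw [MulChar.card_pow_eq hn, h3, sum_insert (by simp), ← add_assoc]
    congr 1
    by_cases hu : u = 0
    · simp [hu]
    · simp [hu, MulChar.one_apply (isUnit_iff_ne_zero.2 hu)]
  rw [h1]
  push_cast
  simp only [h2, sum_add_distrib]
  rw [sum_comm]
  simp

end CharacterSums

open scoped Classical in
/-- Let `F` be a finite field with `q ≡ 1 (mod 5)` elements of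
characteristic `p ≠ 5`, let `λ ∈ F*`, and let `1 ≤ a, b ≤ 4`. The number of pairs
`(x, y) ∈ F × F` with `y⁵ = x^a (1-x)^b (1-λx)^{5-b}` equals
`q + ∑_χ (1/(q-1)) ∑_η q^{1-ν} G(φ,χ^a η) G(φ,χ^b η) / (G(φ,η) G(φ,χ^{a+b} η)) η(λ)`,
where the outer sum runs over nontrivial multiplicative characters `χ` with `χ⁵ = 1`,
the inner sum over all multiplicative characters `η`, and `ν` is the number of trivial
characters among the pair `(η, χ^{a+b} η)`. -/
theorem stmt_6 {F : Type*} [Field F] [Fintype F] (hchar : ringChar F ≠ 5)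
    (hq : Fintype.card F % 5 = 1) (φ : AddChar F ℂ) (hφ : φ ≠ 1)
    (lam : F) (hlam : lam ≠ 0) (a b : ℕ) (ha1 : 1 ≤ a) (ha4 : a ≤ 4)
    (hb1 : 1 ≤ b) (hb4 : b ≤ 4) :
    (Nat.card {pt : F × F //
        pt.2 ^ 5 = pt.1 ^ a * (1 - pt.1) ^ b * (1 - lam * pt.1) ^ (5 - b)} : ℂ) =
      (Fintype.card F : ℂ) +
        ∑ χ ∈ Finset.univ.filter (fun χ : MulChar F ℂ => χ ≠ 1 ∧ χ ^ 5 = 1),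
          (1 / ((Fintype.card F : ℂ) - 1)) *
            ∑ η : MulChar F ℂ,
              (Fintype.card F : ℂ) ^
                  ((1 : ℤ) - ((if η = 1 then 1 else 0) +
                    (if χ ^ (a + b) * η = 1 then 1 else 0))) *
                (gaussSum' φ (χ ^ a * η) * gaussSum' φ (χ ^ b * η)) /
                (gaussSum' φ η * gaussSum' φ (χ ^ (a + b) * η)) * η lam := by
  rw [MulChar.card_pow_eq_apply (by norm_num)
    (fun x => x ^ a * (1 - x) ^ b * (1 - lam * x) ^ (5 - b))]
  congr 1
  refine Finset.sum_congr rfl fun χ hχ => ?_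
  obtain ⟨hχ1, hχ5⟩ := (Finset.mem_filter.1 hχ).2
  have hord : orderOf χ = 5 := haveI : Fact (Nat.Prime 5) := ⟨Nat.prime_five⟩
    orderOf_eq_prime hχ5 hχ1
  have hneg : χ (-1) = 1 := by
    have h : (χ ^ 5) (-1) = χ (-1) := by
      rw [MulChar.pow_apply' χ (by norm_num), ← map_pow, Odd.neg_one_pow (by decide)]
    rw [← h, hχ5, MulChar.one_apply isUnit_one.neg]
  have hpow {n : ℕ} (hn : n ≠ 0) : (χ ^ n) (-1) = 1 := by
    rw [MulChar.pow_apply' χ hn, hneg, one_pow]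
  have hb : χ ^ b ≠ 1 := fun h =>
    Nat.not_dvd_of_pos_of_lt hb1 (by omega) (hord ▸ orderOf_dvd_of_pow_eq_one h)
  have hbinv : χ ^ (5 - b) = (χ ^ b)⁻¹ := by
    rw [eq_inv_iff_mul_eq_one, ← pow_add, Nat.sub_add_cancel (by omega), hχ5]
  have hq0 : (Fintype.card F : ℂ) ≠ 0 := Nat.cast_ne_zero.2 Fintype.card_ne_zero
  have hq1 : (Fintype.card F : ℂ) - 1 ≠ 0 := by
    rw [sub_ne_zero]
    exact_mod_cast Fintype.one_lt_card.ne'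
  simp only [gaussSum'_quotient hφ (hpow (show a + b ≠ 0 by omega))]
  rw [← Finset.mul_sum, pow_add, sum_prod_gaussSum'_eq_sum_apply hφ hb
    (hpow (by omega)) (hpow (by omega)) hlam, ← hbinv]
  simp only [map_mul, map_pow, MulChar.pow_apply' χ (show a ≠ 0 by omega),
    MulChar.pow_apply' χ (show b ≠ 0 by omega), MulChar.pow_apply' χ (show 5 - b ≠ 0 by omega)]
  field_simp
  simp only [mul_comm lam]
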